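/- Let I ⊂ S be a quadratic monomial ideal with linear resolution. Then, up to relabeling of the variables, I = x_1·P + J, where P = (u/x_1 : u ∈ G(I) divisible by x_1) and J = (u ∈ G(I) : x_1 does not divide u), with J ⊆ P, and moreover J has a linear resolution. -/

import Mathlib

open MvPolynomial

/-- `I` has a `d`-linear (free) resolution: there is a resolution
`... → S^{r 2} → S^{r 1} → S^{r 0} → I → 0` in which the generators of `S^{r 0}` map to
homogeneous generators of `I` of degree `d` and all matrices have entries which are
homogeneous of degree `1`.  (Its existence is equivalent to all graded Betti numbers
`β_{i,j}(I)` vanishing for `j ≠ i + d`.) -/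
def HasLinearResolution {K : Type*} [Field K] {σ : Type*}
    (I : Ideal (MvPolynomial σ K)) (d : ℕ) : Prop :=
  ∃ (r : ℕ → ℕ) (g : Fin (r 0) → MvPolynomial σ K)
    (M : (i : ℕ) → Fin (r i) → Fin (r (i + 1)) → MvPolynomial σ K),
    (∀ j, (g j).IsHomogeneous d) ∧
    I = Ideal.span (Set.range g) ∧
    (∀ i j k, (M i j k).IsHomogeneous 1) ∧
    (∀ v : Fin (r 0) → MvPolynomial σ K,
      (∑ j, v j * g j) = 0 ↔
        ∃ w : Fin (r 1) → MvPolynomial σ K, v = fun j => ∑ k, M 0 j k * w k) ∧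
    (∀ (i : ℕ) (v : Fin (r (i + 1)) → MvPolynomial σ K),
      ((fun j => ∑ k, M i j k * v k) = fun _ => 0) ↔
        ∃ w : Fin (r (i + 2)) → MvPolynomial σ K, v = fun k => ∑ l, M (i + 1) k l * w l)

section Restriction

variable {K : Type*} [Field K] {σ : Type*}

/-- The substitution `x_i ↦ 0`, as an endomorphism of the polynomial ring. -/
noncomputable def setZero [DecidableEq σ] (i : σ) : MvPolynomial σ K →ₐ[K] MvPolynomial σ K :=
  aeval (Function.update X i 0)

theorem setZero_monomial [DecidableEq σ] (i : σ) (a : σ →₀ ℕ) (c : K) :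
    setZero i (monomial a c) = if a i = 0 then monomial a c else 0 := by
  rw [setZero, aeval_monomial]
  split_ifs with h
  · rw [monomial_eq]
    congr 1
    refine Finsupp.prod_congr fun j hj => ?_
    rw [Function.update_of_ne]
    rintro rfl
    simp [h] at hj
  · rw [Finsupp.prod, Finset.prod_eq_zero (i := i) (by simpa using h) (by simp [h]), mul_zero]

theorem coeff_setZero [DecidableEq σ] (i : σ) (p : MvPolynomial σ K) (m : σ →₀ ℕ) :
    coeff m (setZero i p) = if m i = 0 then coeff m p else 0 := by
  induction p using MvPolynomial.induction_on' with
  | monomial a c =>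
    rw [setZero_monomial]
    by_cases h : a = m
    · subst h; split_ifs <;> simp
    · split_ifs <;> simp [coeff_monomial, h]
  | add p q hp hq =>
    rw [map_add, coeff_add, hp, hq]
    split_ifs <;> simp

theorem setZero_setZero [DecidableEq σ] (i : σ) (p : MvPolynomial σ K) :
    setZero i (setZero i p) = setZero i p := by
  ext m
  simp only [coeff_setZero]
  split_ifs <;> rfl

theorem setZero_C [DecidableEq σ] (i : σ) (c : K) :
    setZero i (C c : MvPolynomial σ K) = C c := by
  simp [setZero]

theorem isHomogeneous_setZero [DecidableEq σ] {p : MvPolynomial σ K} {d : ℕ}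
    (hp : p.IsHomogeneous d) (i : σ) : (setZero i p).IsHomogeneous d := by
  intro m hm
  rw [coeff_setZero] at hm
  split_ifs at hm with h
  · exact hp hm
  · exact absurd rfl hm

theorem setZero_add_X_mul_divMonomial [DecidableEq σ] (i : σ) (p : MvPolynomial σ K) :
    p = setZero i p + X i * p.divMonomial (Finsupp.single i 1) := by
  ext m
  rw [coeff_add, coeff_setZero, coeff_X_mul', coeff_divMonomial]
  by_cases h : m i = 0
  · simp [h]
  · have hle : Finsupp.single i 1 ≤ m := by
      rw [Finsupp.single_le_iff]; omega
    simp [h, add_tsub_cancel_of_le hle]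

theorem map_setZero_span_monomial [DecidableEq σ] (i : σ) (A : Set (σ →₀ ℕ)) :
    Ideal.map (setZero i)
        (Ideal.span ((fun a => (monomial a (1 : K) : MvPolynomial σ K)) '' A)) =
      Ideal.span ((fun a => (monomial a (1 : K) : MvPolynomial σ K)) '' {a ∈ A | a i = 0}) := by
  rw [Ideal.map_span]
  apply le_antisymm
  · rw [Ideal.span_le]
    rintro _ ⟨_, ⟨a, ha, rfl⟩, rfl⟩
    simp only [setZero_monomial]
    split_ifs with h
    · exact Ideal.subset_span ⟨a, ⟨ha, h⟩, rfl⟩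
    · exact Ideal.zero_mem _
  · rw [Ideal.span_le]
    rintro _ ⟨a, ⟨ha, h⟩, rfl⟩
    refine Ideal.subset_span ⟨_, ⟨a, ha, rfl⟩, ?_⟩
    simp [setZero_monomial, h]

theorem homogeneousComponent_mul_of_isHomogeneous {p : MvPolynomial σ K} {e : ℕ}
    (hp : p.IsHomogeneous e) (k : ℕ) (q : MvPolynomial σ K) :
    homogeneousComponent (e + k) (p * q) = p * homogeneousComponent k q := by
  let := MvPolynomial.gradedAlgebra (σ := σ) (R := K)
  have h := DirectSum.coe_decompose_mul_add_of_left_mem (homogeneousSubmodule σ K)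
    (a := p) (b := q) (i := e) (j := k) hp
  rwa [← decomposition.decompose'_apply, ← decomposition.decompose'_apply]

open Matrix in
/-- A homogeneous vector in the image of a homogeneous matrix lifts to a homogeneous vector. -/
theorem mulVec_homogeneousComponent {a b : Type*} [Fintype b] {e k : ℕ}
    {D : Matrix a b (MvPolynomial σ K)} (hD : ∀ j l, (D j l).IsHomogeneous e)
    {v : a → MvPolynomial σ K} (hv : ∀ j, (v j).IsHomogeneous (e + k))
    {w : b → MvPolynomial σ K} (h : v = D *ᵥ w) :
    v = D *ᵥ fun l => homogeneousComponent k (w l) := by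
  funext j
  rw [← homogeneousComponent_eq_self (hv j), h]
  simp only [mulVec, dotProduct, map_sum]
  exact Finset.sum_congr rfl fun l _ => homogeneousComponent_mul_of_isHomogeneous (hD j l) k _

end Restriction

section Resolution

open Matrix

variable {K : Type*} [Field K] {σ : Type*}

/-- A matrix of scalars, viewed as a matrix of constant polynomials. -/
noncomputable def constMatrix (σ : Type*) {a b : Type*} (E : Matrix a b K) :
    Matrix a b (MvPolynomial σ K) :=
  E.map C

/-- The substitution `x_i ↦ 0`, applied to all entries of a matrix. -/
noncomputable def zeroMatrixVar [DecidableEq σ] {a b : Type*} (i : σ)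
    (D : Matrix a b (MvPolynomial σ K)) : Matrix a b (MvPolynomial σ K) :=
  D.map (setZero i)

theorem constMatrix_mul {a b c : Type*} [Fintype b] (E : Matrix a b K) (F : Matrix b c K) :
    constMatrix σ (E * F) = constMatrix σ E * constMatrix σ F :=
  Matrix.map_mul

theorem constMatrix_one {a : Type*} [DecidableEq a] :
    constMatrix σ (1 : Matrix a a K) = 1 :=
  Matrix.map_one _ C.map_zero C.map_one

theorem zeroMatrixVar_mul [DecidableEq σ] {a b c : Type*} [Fintype b] (i : σ)
    (D : Matrix a b (MvPolynomial σ K)) (D' : Matrix b c (MvPolynomial σ K)) :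
    zeroMatrixVar i (D * D') = zeroMatrixVar i D * zeroMatrixVar i D' :=
  Matrix.map_mul

theorem zeroMatrixVar_mulVec [DecidableEq σ] {a b : Type*} [Fintype b] (i : σ)
    (D : Matrix a b (MvPolynomial σ K)) (v : b → MvPolynomial σ K) :
    setZero i ∘ (D *ᵥ v) = zeroMatrixVar i D *ᵥ (setZero i ∘ v) := by
  funext j
  simp [zeroMatrixVar, mulVec, dotProduct]

theorem zeroMatrixVar_constMatrix [DecidableEq σ] {a b : Type*} (i : σ) (E : Matrix a b K) :
    zeroMatrixVar i (constMatrix σ E) = constMatrix σ E := by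
  refine Matrix.ext fun j k => ?_
  exact setZero_C i _

theorem zeroMatrixVar_zeroMatrixVar [DecidableEq σ] {a b : Type*} (i : σ)
    (D : Matrix a b (MvPolynomial σ K)) :
    zeroMatrixVar i (zeroMatrixVar i D) = zeroMatrixVar i D := by
  refine Matrix.ext fun j k => ?_
  exact setZero_setZero i _

/-- The sequence of free modules given by the matrices `D` and `D'` is exact in the middle. -/
def ExactAt {R : Type*} [CommRing R] {a b c : Type*} [Fintype b] [Fintype c]
    (D : Matrix a b R) (D' : Matrix b c R) : Prop :=
  ∀ v, D *ᵥ v = 0 ↔ ∃ w, v = D' *ᵥ w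

theorem ExactAt.mul_eq_zero {R : Type*} [CommRing R] {a b c : Type*} [Fintype b] [Fintype c]
    {D : Matrix a b R} {D' : Matrix b c R} (h : ExactAt D D') : D * D' = 0 := by
  classical
  refine Matrix.ext_of_mulVec_single fun k => ?_
  rw [← mulVec_mulVec, (h _).2 ⟨_, rfl⟩, zero_mulVec]

theorem ExactAt.exists_eq_mul {R : Type*} [CommRing R] {a b c e : Type*} [Fintype b] [Fintype c]
    {D : Matrix a b R} {D' : Matrix b c R} (h : ExactAt D D') {N : Matrix b e R}
    (hN : D * N = 0) : ∃ L : Matrix c e R, N = D' * L := by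
  have hcol : ∀ k, ∃ w, N.col k = D' *ᵥ w := fun k => (h _).1 <| by
    funext j
    exact congrFun (congrFun hN j) k
  choose w hw using hcol
  refine ⟨Matrix.of fun l k => w k l, ?_⟩
  refine Matrix.ext fun j k => ?_
  exact congrFun (hw k) j

/-- A resolution with linear matrices has no nonzero constant syzygies. -/
theorem ExactAt.constMatrix_injective {a b c e : Type*} [Fintype b] [Fintype c]
    {D : Matrix a b (MvPolynomial σ K)} {D' : Matrix b c (MvPolynomial σ K)}
    (h : ExactAt D D') (hD' : ∀ j k, (D' j k).IsHomogeneous 1) {E F : Matrix b e K}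
    (hEF : D * constMatrix σ E = D * constMatrix σ F) : E = F := by
  have h0 : D * (constMatrix σ E - constMatrix σ F) = 0 := by rw [Matrix.mul_sub, hEF, sub_self]
  obtain ⟨L, hL⟩ := h.exists_eq_mul h0
  ext j k
  have h1 := congrArg constantCoeff (congrFun (congrFun hL j) k)
  have h2 : ∀ l, constantCoeff (D' j l) = 0 := fun l => by
    by_contra hne
    simpa using hD' j l hne
  simp [Matrix.mul_apply, h2, constMatrix] at h1
  exact sub_eq_zero.1 h1

/-- Factorization of homogeneous matrices of the same degree has constant coefficients. -/
theorem exists_eq_mul_constMatrix {a b e : Type*} [Fintype b] {d : ℕ}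
    {D : Matrix a b (MvPolynomial σ K)} (hD : ∀ j k, (D j k).IsHomogeneous d)
    {N : Matrix a e (MvPolynomial σ K)} (hN : ∀ j k, (N j k).IsHomogeneous d)
    {L : Matrix b e (MvPolynomial σ K)} (h : N = D * L) :
    ∃ E : Matrix b e K, N = D * constMatrix σ E := by
  refine ⟨Matrix.of fun l k => coeff 0 (L l k), ?_⟩
  refine Matrix.ext fun j k => ?_
  have hcol : N.col k = D *ᵥ L.col k := by
    funext j
    exact congrFun (congrFun h j) k
  have := mulVec_homogeneousComponent (k := 0) hD (v := N.col k) (fun j => hN j k) hcol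
  simp only [homogeneousComponent_zero] at this
  exact congrFun this j

theorem isHomogeneous_constMatrix_mul {a b e : Type*} [Fintype b] {d : ℕ} (E : Matrix a b K)
    {D : Matrix b e (MvPolynomial σ K)} (hD : ∀ j k, (D j k).IsHomogeneous d) (j : a) (k : e) :
    ((constMatrix σ E * D) j k).IsHomogeneous d := by
  rw [Matrix.mul_apply]
  refine IsHomogeneous.sum _ _ _ fun l _ => ?_
  simpa [constMatrix] using (isHomogeneous_C σ (E j l)).mul (hD l k)

theorem isHomogeneous_mul_constMatrix {a b e : Type*} [Fintype b] {d : ℕ} (E : Matrix b e K)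
    {D : Matrix a b (MvPolynomial σ K)} (hD : ∀ j k, (D j k).IsHomogeneous d) (j : a) (k : e) :
    ((D * constMatrix σ E) j k).IsHomogeneous d := by
  rw [Matrix.mul_apply]
  refine IsHomogeneous.sum _ _ _ fun l _ => ?_
  simpa [constMatrix] using (hD j l).mul (isHomogeneous_C σ (E l k))

/-- An idempotent matrix over a field factors through a free module of its rank. -/
theorem exists_factor_of_idempotent {m : Type*} [Fintype m] [DecidableEq m] (E : Matrix m m K)
    (hE : E * E = E) :
    ∃ (k : ℕ) (P : Matrix m (Fin k) K) (Q : Matrix (Fin k) m K), P * Q = E ∧ Q * P = 1 := by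
  let f := Matrix.toLin' E
  let b := Module.finBasis K (LinearMap.range f)
  let s := Pi.basisFun K m
  refine ⟨_, LinearMap.toMatrix b s (LinearMap.range f).subtype,
    LinearMap.toMatrix s b f.rangeRestrict, ?_, ?_⟩
  · rw [← LinearMap.toMatrix_comp]
    have : (LinearMap.range f).subtype ∘ₗ f.rangeRestrict = f := by ext; rfl
    rw [this]
    exact (congrFun (congrArg _ (LinearMap.toMatrix_eq_toMatrix' (R := K))) f).trans
      (LinearMap.toMatrix'_toLin' E)
  · rw [← LinearMap.toMatrix_comp]
    have : f.rangeRestrict ∘ₗ (LinearMap.range f).subtype = LinearMap.id := by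
      ext ⟨_, y, rfl⟩ : 2
      change f (f y) = f y
      simp only [f, Matrix.toLin'_apply, mulVec_mulVec, hE]
    rw [this, LinearMap.toMatrix_id]

/-- Exactness of a sequence not involving `x_i` may be tested on vectors not involving `x_i`. -/
theorem exactAt_of_setZero [DecidableEq σ] {a b c : Type*} [Fintype b] [Fintype c] (i : σ)
    {D : Matrix a b (MvPolynomial σ K)} {D' : Matrix b c (MvPolynomial σ K)}
    (hD : zeroMatrixVar i D = D) (hDD' : D * D' = 0)
    (h : ∀ v, setZero i ∘ v = v → D *ᵥ v = 0 → ∃ w, v = D' *ᵥ w) : ExactAt D D' := by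
  have key : ∀ (N : ℕ) (v : b → MvPolynomial σ K),
      (∀ j m, N ≤ m i → coeff m (v j) = 0) → D *ᵥ v = 0 → ∃ w, v = D' *ᵥ w := by
    intro N
    induction N with
    | zero =>
      intro v hv _
      refine ⟨0, ?_⟩
      rw [mulVec_zero]
      funext j
      ext m
      simpa using hv j m (Nat.zero_le _)
    | succ N ih =>
      intro v hv hDv
      set v' : b → MvPolynomial σ K := fun j => (v j).divMonomial (Finsupp.single i 1) with hv'
      have hdec : v = setZero i ∘ v + (X i : MvPolynomial σ K) • v' := by
        funext j
        exact setZero_add_X_mul_divMonomial i (v j)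
      have h0 : D *ᵥ (setZero i ∘ v) = 0 := by
        rw [← hD, ← zeroMatrixVar_mulVec, hDv]
        funext j
        simp
      have h1 : D *ᵥ v' = 0 := by
        rw [hdec, mulVec_add, h0, zero_add, mulVec_smul] at hDv
        exact (smul_eq_zero.1 hDv).resolve_left (X_ne_zero i)
      have hfix : setZero i ∘ (setZero i ∘ v) = setZero i ∘ v := by
        funext j
        simp only [Function.comp_apply, setZero_setZero]
      obtain ⟨w, hw⟩ := h (setZero i ∘ v) hfix h0
      have hdeg : ∀ j m, N ≤ m i → coeff m (v' j) = 0 := by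
        intro j m hm
        simp only [hv', coeff_divMonomial]
        refine hv j _ ?_
        simp only [Finsupp.add_apply, Finsupp.single_eq_same]
        omega
      obtain ⟨w', hw'⟩ := ih v' hdeg h1
      refine ⟨w + (X i : MvPolynomial σ K) • w', ?_⟩
      rw [mulVec_add, mulVec_smul, ← hw, ← hw', ← hdec]
  intro v
  constructor
  · intro hv
    refine key (Finset.univ.sup fun j => (degreeOf i (v j) + 1)) v (fun j m hm => ?_) hv
    by_contra hne
    have h1 := (Finset.le_sup (f := fun j => (degreeOf i (v j) + 1)) (Finset.mem_univ j)).trans hm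
    have h2 := degreeOf_le_iff.1 (le_refl (degreeOf i (v j))) m (mem_support_iff.2 hne)
    omega
  · rintro ⟨w, rfl⟩
    rw [mulVec_mulVec, hDD', zero_mulVec]

/-- Exactness is inherited by the images of compatible idempotents. -/
theorem ExactAt.restrict [DecidableEq σ] {a b c a₁ b₁ c₁ : Type*} [Fintype a] [Fintype b]
    [Fintype c] [Fintype a₁] [Fintype b₁] [Fintype c₁] [DecidableEq b₁] (i : σ)
    {D : Matrix a b (MvPolynomial σ K)} {D' : Matrix b c (MvPolynomial σ K)} (h : ExactAt D D')
    {Pa : Matrix a a₁ K} {Qa : Matrix a₁ a K} {Pb : Matrix b b₁ K} {Qb : Matrix b₁ b K}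
    {Pc : Matrix c c₁ K} {Qc : Matrix c₁ c K} (hb : Qb * Pb = 1)
    (hD : constMatrix σ (Pa * Qa) * zeroMatrixVar i D = D * constMatrix σ (Pb * Qb))
    (hD' : constMatrix σ (Pb * Qb) * zeroMatrixVar i D' = D' * constMatrix σ (Pc * Qc)) :
    ExactAt (constMatrix σ Qa * zeroMatrixVar i D * constMatrix σ Pb)
      (constMatrix σ Qb * zeroMatrixVar i D' * constMatrix σ Pc) := by
  have hb' : constMatrix σ Qb * constMatrix σ Pb = (1 : Matrix b₁ b₁ (MvPolynomial σ K)) := by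
    rw [← constMatrix_mul, hb, constMatrix_one]
  rw [constMatrix_mul, constMatrix_mul] at hD hD'
  have hφ : constMatrix σ Pb * constMatrix σ Qb * zeroMatrixVar i D' =
      zeroMatrixVar i D' * (constMatrix σ Pc * constMatrix σ Qc) := by
    have := congrArg (zeroMatrixVar i) hD'
    simpa only [zeroMatrixVar_mul, zeroMatrixVar_constMatrix, zeroMatrixVar_zeroMatrixVar] using this
  have hzero : zeroMatrixVar i D * zeroMatrixVar i D' = 0 := by
    rw [← zeroMatrixVar_mul, h.mul_eq_zero]
    exact Matrix.map_zero _ (map_zero _)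
  refine exactAt_of_setZero i ?_ ?_ ?_
  · simp only [zeroMatrixVar_mul, zeroMatrixVar_constMatrix, zeroMatrixVar_zeroMatrixVar]
  · calc _ = constMatrix σ Qa * zeroMatrixVar i D * (constMatrix σ Pb * constMatrix σ Qb * zeroMatrixVar i D') *
        constMatrix σ Pc := by simp only [Matrix.mul_assoc]
      _ = constMatrix σ Qa * (zeroMatrixVar i D * zeroMatrixVar i D') * (constMatrix σ Pc * constMatrix σ Qc) *
        constMatrix σ Pc := by rw [hφ]; simp only [Matrix.mul_assoc]
      _ = 0 := by rw [hzero]; simp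
  · intro v hv hker
    have h1 : D *ᵥ (constMatrix σ Pb *ᵥ v) = 0 := by
      calc D *ᵥ (constMatrix σ Pb *ᵥ v) = (D * (constMatrix σ Pb * constMatrix σ Qb)) *ᵥ (constMatrix σ Pb *ᵥ v) := by
            rw [mulVec_mulVec, mulVec_mulVec]
            congr 1
            rw [Matrix.mul_assoc, Matrix.mul_assoc, hb', Matrix.mul_one]
        _ = constMatrix σ Pa *ᵥ ((constMatrix σ Qa * zeroMatrixVar i D * constMatrix σ Pb) *ᵥ v) := by
            rw [← hD, mulVec_mulVec, mulVec_mulVec]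
            simp only [Matrix.mul_assoc]
        _ = 0 := by rw [hker, mulVec_zero]
    obtain ⟨w, hw⟩ := (h _).1 h1
    have h2 : constMatrix σ Pb *ᵥ v = zeroMatrixVar i D' *ᵥ (setZero i ∘ w) := by
      conv_lhs => rw [← hv, ← zeroMatrixVar_constMatrix i Pb]
      rw [← zeroMatrixVar_mulVec, hw, zeroMatrixVar_mulVec]
    refine ⟨constMatrix σ Qc *ᵥ (setZero i ∘ w), ?_⟩
    calc v = (constMatrix σ Qb * constMatrix σ Pb * constMatrix σ Qb) *ᵥ (constMatrix σ Pb *ᵥ v) := by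
          rw [mulVec_mulVec, hb', Matrix.one_mul, hb', one_mulVec]
      _ = _ := by
          rw [h2, mulVec_mulVec, mulVec_mulVec]
          congr 1
          calc _ = constMatrix σ Qb * (constMatrix σ Pb * constMatrix σ Qb * zeroMatrixVar i D') := by
                simp only [Matrix.mul_assoc]
            _ = _ := by rw [hφ]; simp only [Matrix.mul_assoc]

end Resolution

section Restrict

open Matrix

variable {K : Type*} [Field K] {σ : Type*}

theorem exists_dependent_seq {α : ℕ → Type*} (p : ∀ i, α i → Prop)
    (rel : ∀ i, α i → α (i + 1) → Prop) {a : α 0} (ha : p 0 a)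
    (hs : ∀ i a, p i a → ∃ b, p (i + 1) b ∧ rel i a b) :
    ∃ s : ∀ i, α i, s 0 = a ∧ ∀ i, p i (s i) ∧ rel i (s i) (s (i + 1)) := by
  choose f hf using hs
  let t : ∀ i, {x : α i // p i x} := fun i =>
    Nat.rec ⟨a, ha⟩ (fun i x => ⟨f i x.1 x.2, (hf i x.1 x.2).1⟩) i
  exact ⟨fun i => (t i).1, rfl, fun i => ⟨(t i).2, (hf i (t i).1 (t i).2).2⟩⟩

theorem exactAt_replicateRow_iff {R : Type*} [CommRing R] {b c : Type*} [Fintype b] [Fintype c]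
    {g : b → R} {D : Matrix b c R} :
    ExactAt (replicateRow Unit g) D ↔
      ∀ v : b → R, ∑ j, v j * g j = 0 ↔ ∃ w : c → R, v = fun j => ∑ k, D j k * w k := by
  refine forall_congr' fun v => ?_
  have : replicateRow Unit g *ᵥ v = 0 ↔ ∑ j, v j * g j = 0 := by
    simp [funext_iff, mulVec, dotProduct, mul_comm]
  rw [this]
  rfl

theorem hasLinearResolution_iff {I : Ideal (MvPolynomial σ K)} {d : ℕ} :
    HasLinearResolution I d ↔
      ∃ (r : ℕ → ℕ) (g : Fin (r 0) → MvPolynomial σ K)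
        (M : (i : ℕ) → Matrix (Fin (r i)) (Fin (r (i + 1))) (MvPolynomial σ K)),
        (∀ j, (g j).IsHomogeneous d) ∧ I = Ideal.span (Set.range g) ∧
        (∀ i j k, (M i j k).IsHomogeneous 1) ∧
        ExactAt (replicateRow Unit g) (M 0) ∧ ∀ i, ExactAt (M i) (M (i + 1)) := by
  simp only [exactAt_replicateRow_iff]
  rfl

/-- A constant endomorphism of a term of a linear resolution, compatible with the substitution
`x_i ↦ 0`, induces one on the next term. -/
theorem exists_compatible_idempotent [DecidableEq σ] {a b c : Type*} [Fintype a] [Fintype b]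
    [Fintype c] [DecidableEq a] (i : σ) {d : ℕ}
    {D : Matrix a b (MvPolynomial σ K)} {D' : Matrix b c (MvPolynomial σ K)} (h : ExactAt D D')
    (hD : ∀ j k, (D j k).IsHomogeneous d) (hD' : ∀ j k, (D' j k).IsHomogeneous 1)
    {F : Matrix a a K} (hF : F * F = F)
    (hFD : ∃ L : Matrix b b (MvPolynomial σ K), constMatrix σ F * zeroMatrixVar i D = D * L) :
    ∃ E : Matrix b b K, (E * E = E ∧ ∃ L : Matrix c c (MvPolynomial σ K),
        constMatrix σ E * zeroMatrixVar i D' = D' * L) ∧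
      constMatrix σ F * zeroMatrixVar i D = D * constMatrix σ E := by
  obtain ⟨L, hL⟩ := hFD
  obtain ⟨E, hE⟩ := exists_eq_mul_constMatrix (N := constMatrix σ F * zeroMatrixVar i D) hD
    (isHomogeneous_constMatrix_mul F fun j k => isHomogeneous_setZero (hD j k) i) hL
  have hφ : constMatrix σ F * zeroMatrixVar i D = zeroMatrixVar i D * constMatrix σ E := by
    have := congrArg (zeroMatrixVar i) hE
    simpa only [zeroMatrixVar_mul, zeroMatrixVar_constMatrix, zeroMatrixVar_zeroMatrixVar]
      using this
  refine ⟨E, ⟨h.constMatrix_injective hD' ?_, ?_⟩, hE⟩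
  · rw [constMatrix_mul, ← Matrix.mul_assoc, ← hE, Matrix.mul_assoc, ← hφ, ← Matrix.mul_assoc,
      ← constMatrix_mul, hF]
  · refine h.exists_eq_mul ?_
    rw [← Matrix.mul_assoc, ← hE, Matrix.mul_assoc, ← zeroMatrixVar_mul, h.mul_eq_zero]
    have : zeroMatrixVar i (0 : Matrix a c (MvPolynomial σ K)) = 0 :=
      Matrix.map_zero _ (map_zero _)
    rw [this, Matrix.mul_zero]

/-- If an ideal with linear resolution is stable under the substitution `x_i ↦ 0`, then the
ideal generated by its image has a linear resolution. -/
theorem HasLinearResolution.map_setZero [DecidableEq σ] {I : Ideal (MvPolynomial σ K)} {d : ℕ}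
    (hI : HasLinearResolution I d) (i : σ) (hle : I.map (setZero i) ≤ I) :
    HasLinearResolution (I.map (setZero i)) d := by
  obtain ⟨r, g, M, hg, rfl, hM, hex0, hex⟩ := hasLinearResolution_iff.1 hI
  have hrow : ∀ j k, (replicateRow Unit g j k).IsHomogeneous d := fun _ k => hg k
  have hrow' : ∃ L : Matrix (Fin (r 0)) (Fin (r 0)) (MvPolynomial σ K),
      constMatrix σ (1 : Matrix Unit Unit K) *
      zeroMatrixVar i (replicateRow Unit g) = replicateRow Unit g * L := by
    have : ∀ k, ∃ w : Fin (r 0) → MvPolynomial σ K, ∑ j, w j * g j = setZero i (g k) := by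
      intro k
      have : setZero i (g k) ∈ Ideal.span (Set.range g) :=
        hle (Ideal.mem_map_of_mem _ (Ideal.subset_span ⟨k, rfl⟩))
      exact (Ideal.mem_span_range_iff_exists_fun).1 this
    choose w hw using this
    refine ⟨Matrix.of fun l k => w k l, ?_⟩
    rw [constMatrix_one, Matrix.one_mul]
    refine Matrix.ext fun j k => ?_
    rw [mul_apply]
    exact (hw k).symm.trans (Finset.sum_congr rfl fun _ _ => mul_comm _ _)
  obtain ⟨E₀, hE₀, hE₀'⟩ := exists_compatible_idempotent i hex0 hrow (hM 0) (Matrix.one_mul 1) hrow'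
  obtain ⟨E, rfl, hE⟩ := exists_dependent_seq
    (fun k (F : Matrix (Fin (r k)) (Fin (r k)) K) => F * F = F ∧
      ∃ L : Matrix (Fin (r (k + 1))) (Fin (r (k + 1))) (MvPolynomial σ K),
        constMatrix σ F * zeroMatrixVar i (M k) = M k * L)
    (fun k F F' => constMatrix σ F * zeroMatrixVar i (M k) = M k * constMatrix σ F')
    hE₀ (fun k F hF => exists_compatible_idempotent i (hex k) (hM k) (hM (k + 1)) hF.1 hF.2)
  choose ρ P Q hPQ hQP using fun k => exists_factor_of_idempotent (E k) (hE k).1.1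
  have hcomp : ∀ k, constMatrix σ (P k * Q k) * zeroMatrixVar i (M k) =
      M k * constMatrix σ (P (k + 1) * Q (k + 1)) := fun k => by
    rw [hPQ, hPQ]
    exact (hE k).2
  rw [← hPQ 0] at hE₀'
  have hrow₁ : (replicateRow Unit fun j => ∑ k, setZero i (g k) * C (P 0 k j)) =
      constMatrix σ (1 : Matrix Unit Unit K) * zeroMatrixVar i (replicateRow Unit g) *
        constMatrix σ (P 0) := by
    rw [constMatrix_one, Matrix.one_mul]
    refine Matrix.ext fun j k => ?_
    rw [mul_apply]
    rfl
  have hgen : ∀ k, setZero i (g k) =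
      ∑ j, (∑ l, setZero i (g l) * C (P 0 l j)) * C (Q 0 j k) := by
    have h1 := congrArg (zeroMatrixVar i) hE₀'
    simp only [zeroMatrixVar_mul, zeroMatrixVar_constMatrix, zeroMatrixVar_zeroMatrixVar] at h1
    rw [constMatrix_mul, ← Matrix.mul_assoc, constMatrix_one, Matrix.one_mul] at h1
    intro k
    have h2 := congrFun (congrFun h1 ()) k
    rw [mul_apply] at h2
    refine h2.trans (Finset.sum_congr rfl fun j _ => ?_)
    rw [mul_apply]
    rfl
  refine hasLinearResolution_iff.2 ⟨ρ, fun j => ∑ k, setZero i (g k) * C (P 0 k j),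
    fun k => constMatrix σ (Q k) * zeroMatrixVar i (M k) * constMatrix σ (P (k + 1)),
    ?_, ?_, ?_, ?_, ?_⟩
  · intro j
    refine IsHomogeneous.sum _ _ _ fun l _ => ?_
    simpa using (isHomogeneous_setZero (hg l) i).mul (isHomogeneous_C σ (P 0 l j))
  · rw [Ideal.map_span]
    apply le_antisymm
    · rw [Ideal.span_le]
      rintro _ ⟨_, ⟨k, rfl⟩, rfl⟩
      rw [SetLike.mem_coe, hgen k]
      exact Ideal.sum_mem _ fun j _ => Ideal.mul_mem_right _ _ (Ideal.subset_span ⟨j, rfl⟩)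
    · rw [Ideal.span_le]
      rintro _ ⟨j, rfl⟩
      exact Ideal.sum_mem _ fun k _ => Ideal.mul_mem_right _ _
        (Ideal.subset_span ⟨_, ⟨k, rfl⟩, rfl⟩)
  · intro k
    exact isHomogeneous_mul_constMatrix _ (isHomogeneous_constMatrix_mul _
      fun j l => isHomogeneous_setZero (hM k j l) i)
  · rw [hrow₁]
    exact hex0.restrict i (Pa := 1) (Qa := 1) (hQP 0) (by rw [Matrix.one_mul]; exact hE₀')
      (hcomp 0)
  · exact fun k => (hex k).restrict i (hQP (k + 1)) (hcomp k) (hcomp (k + 1))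

theorem HasLinearResolution.restrict [DecidableEq σ] {A : Set (σ →₀ ℕ)} {d : ℕ}
    (h : HasLinearResolution
      (Ideal.span ((fun a => (monomial a (1 : K) : MvPolynomial σ K)) '' A)) d) (i : σ) :
    HasLinearResolution (Ideal.span
      ((fun a => (monomial a (1 : K) : MvPolynomial σ K)) '' {a ∈ A | a i = 0})) d := by
  rw [← map_setZero_span_monomial]
  refine h.map_setZero i ?_
  rw [map_setZero_span_monomial]
  exact Ideal.span_mono (Set.image_mono fun a ha => ha.1)

theorem HasLinearResolution.restrict_finset [DecidableEq σ] {A : Set (σ →₀ ℕ)} {d : ℕ}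
    (h : HasLinearResolution
      (Ideal.span ((fun a => (monomial a (1 : K) : MvPolynomial σ K)) '' A)) d) (T : Finset σ) :
    HasLinearResolution (Ideal.span
      ((fun a => (monomial a (1 : K) : MvPolynomial σ K)) '' {a ∈ A | ∀ i ∈ T, a i = 0})) d := by
  induction T using Finset.induction_on with
  | empty => simpa using h
  | insert i T _ ih =>
    convert ih.restrict i using 4
    ext a
    simp [and_comm, and_left_comm]

end Restrict

section Euler

open Finset

variable {σ : Type*} [DecidableEq σ]

/-- The exponent vector of the squarefree monomial with support `F`. -/
noncomputable def sqfreeExp (F : Finset σ) : σ →₀ ℕ := ∑ i ∈ F, Finsupp.single i 1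

theorem sqfreeExp_apply (F : Finset σ) (i : σ) : sqfreeExp F i = if i ∈ F then 1 else 0 := by
  simp [sqfreeExp, Finsupp.finsetSum_apply, Finsupp.single_apply]

theorem sqfreeExp_le_iff {F : Finset σ} {c : σ →₀ ℕ} :
    sqfreeExp F ≤ c ↔ ∀ i ∈ F, c i ≠ 0 := by
  rw [Finsupp.le_def]
  refine forall_congr' fun i => ?_
  rw [sqfreeExp_apply]
  split_ifs with h
  · simp [h, Nat.one_le_iff_ne_zero]
  · simp [h]

variable [Fintype σ]

theorem mem_finsuppAntidiag_univ {c : σ →₀ ℕ} {k : ℕ} :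
    c ∈ (univ : Finset σ).finsuppAntidiag k ↔ ∑ i, c i = k := by
  simp only [mem_finsuppAntidiag, subset_univ, and_true]

theorem sum_sqfreeExp (F : Finset σ) : ∑ i, sqfreeExp F i = #F := by
  simp [sqfreeExp_apply]

/-- The generating series of a function on monomials, graded by total degree. -/
noncomputable def degreeSeries (f : (σ →₀ ℕ) → ℤ) : PowerSeries ℤ :=
  PowerSeries.mk fun k => ∑ b ∈ (univ : Finset σ).finsuppAntidiag k, f b

/-- The coefficients of the product of `∏ (1 - x_i)` with the series with coefficients `f`. -/
noncomputable def koszulSum (f : (σ →₀ ℕ) → ℤ) (c : σ →₀ ℕ) : ℤ :=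
  ∑ F ∈ (univ : Finset σ).powerset,
    (-1) ^ #F * if sqfreeExp F ≤ c then f (c - sqfreeExp F) else 0

theorem sum_shift (f : (σ →₀ ℕ) → ℤ) (u : σ →₀ ℕ) (k : ℕ) :
    ∑ c ∈ (univ : Finset σ).finsuppAntidiag k, (if u ≤ c then f (c - u) else 0) =
      if ∑ i, u i ≤ k then ∑ b ∈ (univ : Finset σ).finsuppAntidiag (k - ∑ i, u i), f b
      else 0 := by
  rw [← sum_filter]
  split_ifs with h
  · refine sum_nbij' (fun c => c - u) (fun b => b + u) ?_ ?_ ?_ ?_ ?_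
    · intro c hc
      simp only [mem_filter, mem_finsuppAntidiag_univ] at hc ⊢
      have h1 : ∑ i, (c - u) i + ∑ i, u i = ∑ i, c i := by
        rw [← sum_add_distrib]
        refine sum_congr rfl fun i _ => ?_
        have := hc.2 i
        simp only [Finsupp.tsub_apply]
        omega
      omega
    · intro b hb
      simp only [mem_filter, mem_finsuppAntidiag_univ] at hb ⊢
      refine ⟨?_, le_add_self⟩
      simp only [Finsupp.add_apply, sum_add_distrib, hb]
      omega
    · intro c hc
      exact tsub_add_cancel_of_le (mem_filter.1 hc).2
    · intro b _
      exact add_tsub_cancel_right _ _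
    · intro c _
      rfl
  · refine sum_eq_zero fun c hc => ?_
    simp only [mem_filter, mem_finsuppAntidiag_univ] at hc
    have : ∑ i, u i ≤ ∑ i, c i := sum_le_sum fun i _ => hc.2 i
    omega

theorem coeff_one_sub_X_pow_mul_degreeSeries (f : (σ →₀ ℕ) → ℤ) (k : ℕ) :
    PowerSeries.coeff k ((1 - PowerSeries.X) ^ Fintype.card σ * degreeSeries f) =
      ∑ c ∈ (univ : Finset σ).finsuppAntidiag k, koszulSum f c := by
  have h : (1 - PowerSeries.X : PowerSeries ℤ) ^ Fintype.card σ =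
      ∑ F ∈ (univ : Finset σ).powerset, (-PowerSeries.X) ^ #F := by
    rw [← card_univ, ← prod_const, sub_eq_add_neg, prod_one_add]
    exact sum_congr rfl fun F _ => prod_const _
  unfold koszulSum
  rw [sum_comm, h, sum_mul, map_sum]
  refine sum_congr rfl fun F _ => ?_
  rw [← mul_sum, sum_shift, sum_sqfreeExp, neg_pow, mul_assoc]
  have : ((-1) ^ #F : PowerSeries ℤ) = PowerSeries.C ((-1) ^ #F) := by simp
  rw [this, PowerSeries.coeff_C_mul, PowerSeries.coeff_X_pow_mul']
  simp [degreeSeries]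

theorem koszulSum_eq_zero {f : (σ →₀ ℕ) → ℤ} {c : σ →₀ ℕ} {i : σ} (hi : c i ≠ 0)
    (hf : ∀ b : σ →₀ ℕ, b i + 1 = c i → f (b + Finsupp.single i 1) = f b) :
    koszulSum f c = 0 := by
  unfold koszulSum
  rw [← insert_erase (mem_univ i), sum_powerset_insert (notMem_erase i _), ← sum_add_distrib]
  refine sum_eq_zero fun F hF => ?_
  have hiF : i ∉ F := fun h => notMem_erase i _ (mem_powerset.1 hF h)
  have hins : sqfreeExp (insert i F) = Finsupp.single i 1 + sqfreeExp F := by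
    rw [sqfreeExp, sum_insert hiF, sqfreeExp]
  have hle : sqfreeExp (insert i F) ≤ c ↔ sqfreeExp F ≤ c := by
    simp [sqfreeExp_le_iff, hi]
  rw [card_insert_of_notMem hiF]
  simp only [hle]
  split_ifs with h
  · have hs : Finsupp.single i 1 ≤ c - sqfreeExp F := by
      rw [Finsupp.single_le_iff, Finsupp.tsub_apply, sqfreeExp_apply, if_neg hiF]
      omega
    have hb := hf (c - sqfreeExp (insert i F)) (by
      rw [Finsupp.tsub_apply, sqfreeExp_apply, if_pos (mem_insert_self _ _)]
      omega)
    rw [hins, add_comm (Finsupp.single i 1), ← tsub_tsub, tsub_add_cancel_of_le hs] at hb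
    rw [hins, add_comm (Finsupp.single i 1), ← tsub_tsub, hb]
    ring
  · ring

theorem one_sub_X_pow_mul_degreeSeries_one :
    (1 - PowerSeries.X : PowerSeries ℤ) ^ Fintype.card σ *
      degreeSeries (fun _ : σ →₀ ℕ => 1) = 1 := by
  ext k
  rw [coeff_one_sub_X_pow_mul_degreeSeries, PowerSeries.coeff_one]
  split_ifs with hk
  · subst hk
    rw [finsuppAntidiag_zero, sum_singleton]
    unfold koszulSum
    rw [sum_eq_single ∅]
    · simp [sqfreeExp]
    · intro F _ hF
      obtain ⟨i, hi⟩ := nonempty_iff_ne_empty.2 hF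
      rw [if_neg, mul_zero]
      rw [sqfreeExp_le_iff]
      exact fun h => h i hi rfl
    · simp
  · refine sum_eq_zero fun c hc => ?_
    simp only [mem_finsuppAntidiag_univ] at hc
    obtain ⟨i, -, hi⟩ := exists_ne_zero_of_sum_ne_zero (hc.trans_ne hk)
    exact koszulSum_eq_zero hi fun _ _ => rfl

theorem koszulSum_sqfreeExp (f : (σ →₀ ℕ) → ℤ) (W : Finset σ) :
    koszulSum f (sqfreeExp W) = ∑ a ∈ W.powerset, (-1) ^ (#W + #a) * f (sqfreeExp a) := by
  unfold koszulSum
  have hle : ∀ F : Finset σ, sqfreeExp F ≤ sqfreeExp W ↔ F ⊆ W := fun F => by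
    simp [sqfreeExp_le_iff, sqfreeExp_apply, Finset.subset_iff]
  simp only [hle, mul_ite, mul_zero]
  rw [← sum_filter]
  refine sum_nbij' (fun F => W \ F) (fun a => W \ a) ?_ ?_ ?_ ?_ ?_
  · simp
  · simp
  · intro F hF
    exact Finset.sdiff_sdiff_eq_self (mem_filter.1 hF).2
  · intro a ha
    exact Finset.sdiff_sdiff_eq_self (mem_powerset.1 ha)
  · intro F hF
    have hF := (mem_filter.1 hF).2
    have hcard := card_sdiff_add_card_eq_card hF
    congr 1
    · rw [← hcard, add_right_comm, pow_add, ← two_mul, pow_mul]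
      simp
    · congr 1
      ext i
      simp only [Finsupp.tsub_apply, sqfreeExp_apply, mem_sdiff]
      by_cases h1 : i ∈ W <;> by_cases h2 : i ∈ F <;> simp [h1, h2]

end Euler

section Hilbert

open Matrix

variable {K : Type*} [Field K] {σ : Type*}

theorem homogeneousSubmodule_eq_restrictSupport (k : ℕ) :
    homogeneousSubmodule σ K k = restrictSupport K {b | b.degree = k} :=
  homogeneousSubmodule_eq_finsupp_supported σ K k

theorem finrank_restrictSupport (s : Finset (σ →₀ ℕ)) :
    Module.finrank K (restrictSupport K (s : Set (σ →₀ ℕ))) = s.card := by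
  rw [Module.finrank_eq_card_basis (basisRestrictSupport K (s : Set (σ →₀ ℕ)))]
  simp

theorem coe_finsuppAntidiag_univ [Fintype σ] [DecidableEq σ] (k : ℕ) :
    ((Finset.univ : Finset σ).finsuppAntidiag k : Set (σ →₀ ℕ)) = {b | b.degree = k} := by
  ext b
  rw [Finset.mem_coe, mem_finsuppAntidiag_univ, Set.mem_ofPred_eq, Finsupp.degree_eq_sum]

instance finite_homogeneousSubmodule [Finite σ] (k : ℕ) :
    Module.Finite K (homogeneousSubmodule σ K k) := by
  classical
  have := Fintype.ofFinite σ
  rw [homogeneousSubmodule_eq_restrictSupport, ← coe_finsuppAntidiag_univ]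
  exact Module.Finite.of_basis (basisRestrictSupport K _)

theorem finrank_homogeneousSubmodule [Fintype σ] [DecidableEq σ] (k : ℕ) :
    Module.finrank K (homogeneousSubmodule σ K k) =
      ((Finset.univ : Finset σ).finsuppAntidiag k).card := by
  rw [homogeneousSubmodule_eq_restrictSupport, ← coe_finsuppAntidiag_univ,
    finrank_restrictSupport]

/-- The inclusion of vectors of homogeneous polynomials of degree `k`. -/
noncomputable def gradedInclusion (K σ b : Type*) [Field K] (k : ℕ) :
    (b → homogeneousSubmodule σ K k) →ₗ[K] (b → MvPolynomial σ K) :=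
  (homogeneousSubmodule σ K k).subtype.compLeft b

/-- The map induced by a matrix on vectors of homogeneous polynomials of degree `k`. -/
noncomputable def gradedMap {a b : Type*} [Fintype b] (D : Matrix a b (MvPolynomial σ K))
    (k : ℕ) : (b → homogeneousSubmodule σ K k) →ₗ[K] (a → MvPolynomial σ K) :=
  D.mulVecLin.restrictScalars K ∘ₗ gradedInclusion K σ b k

theorem gradedMap_apply {a b : Type*} [Fintype b] (D : Matrix a b (MvPolynomial σ K))
    (k : ℕ) (v : b → homogeneousSubmodule σ K k) :
    gradedMap D k v = D *ᵥ fun j => (v j : MvPolynomial σ K) :=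
  rfl

theorem finrank_range_add_finrank_ker_gradedMap [Fintype σ] [DecidableEq σ] {a b : Type*}
    [Fintype b] (D : Matrix a b (MvPolynomial σ K)) (k : ℕ) :
    Module.finrank K (LinearMap.range (gradedMap D k)) +
        Module.finrank K (LinearMap.ker (gradedMap D k)) =
      Fintype.card b * ((Finset.univ : Finset σ).finsuppAntidiag k).card := by
  rw [LinearMap.finrank_range_add_finrank_ker, Module.finrank_pi_fintype]
  simp [finrank_homogeneousSubmodule]

theorem ExactAt.finrank_ker_gradedMap_succ {a b c : Type*} [Fintype b] [Fintype c]
    {D : Matrix a b (MvPolynomial σ K)} {D' : Matrix b c (MvPolynomial σ K)} (h : ExactAt D D')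
    (hD' : ∀ j k, (D' j k).IsHomogeneous 1) (k : ℕ) :
    Module.finrank K (LinearMap.ker (gradedMap D (k + 1))) =
      Module.finrank K (LinearMap.range (gradedMap D' k)) := by
  have hinj : Function.Injective (gradedInclusion K σ b (k + 1)) := fun v w hvw =>
    funext fun j => Subtype.ext (congrFun hvw j)
  suffices hmap : Submodule.map (gradedInclusion K σ b (k + 1))
      (LinearMap.ker (gradedMap D (k + 1))) = LinearMap.range (gradedMap D' k) by
    rw [(Submodule.equivMapOfInjective _ hinj _).finrank_eq, hmap]
  ext u
  simp only [Submodule.mem_map, LinearMap.mem_ker, LinearMap.mem_range, gradedMap_apply]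
  constructor
  · rintro ⟨v, hv, rfl⟩
    obtain ⟨w, hw⟩ := (h _).1 hv
    refine ⟨fun l => ⟨homogeneousComponent k (w l), homogeneousComponent_isHomogeneous _ _⟩, ?_⟩
    refine (mulVec_homogeneousComponent hD' (fun j => ?_) hw).symm
    exact add_comm k 1 ▸ (mem_homogeneousSubmodule _ _).1 (v j).2
  · rintro ⟨w, rfl⟩
    refine ⟨fun j => ⟨(D' *ᵥ fun l => (w l : MvPolynomial σ K)) j, ?_⟩, (h _).2 ⟨_, rfl⟩, rfl⟩
    refine IsHomogeneous.sum _ _ _ fun l _ => ?_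
    rw [add_comm]
    exact (hD' j l).mul (w l).2

theorem ExactAt.finrank_ker_gradedMap_zero {a b c : Type*} [Fintype b] [Fintype c]
    {D : Matrix a b (MvPolynomial σ K)} {D' : Matrix b c (MvPolynomial σ K)} (h : ExactAt D D')
    (hD' : ∀ j k, (D' j k).IsHomogeneous 1) :
    Module.finrank K (LinearMap.ker (gradedMap D 0)) = 0 := by
  have hbot : LinearMap.ker (gradedMap D 0) = ⊥ := by
    refine LinearMap.ker_eq_bot'.2 fun v hv => funext fun j => Subtype.ext ?_
    obtain ⟨w, hw⟩ := (h _).1 hv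
    have hj : (v j : MvPolynomial σ K) = ∑ l, D' j l * w l := congrFun hw j
    have hc : constantCoeff (v j : MvPolynomial σ K) = 0 := by
      rw [hj, map_sum]
      refine Finset.sum_eq_zero fun l _ => ?_
      rw [map_mul, constantCoeff_eq, (hD' j l).coeff_eq_zero (by simp), zero_mul]
    have hhom : (v j : MvPolynomial σ K).IsHomogeneous 0 := (v j).2
    have htot := (totalDegree_zero_iff_isHomogeneous _).2 hhom
    rw [totalDegree_eq_zero_iff_eq_C] at htot
    rw [htot, ← constantCoeff_eq, hc, C_0]
    rfl
  rw [hbot, finrank_bot]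

open Classical in
/-- The indicator function of the exponents of the monomials in the ideal generated by the
monomials with exponents in `A`. -/
noncomputable def upperIndicator (A : Set (σ →₀ ℕ)) (b : σ →₀ ℕ) : ℤ :=
  if ∃ a ∈ A, a ≤ b then 1 else 0

theorem finrank_range_gradedMap_replicateRow [Fintype σ] [DecidableEq σ] {b : Type*} [Fintype b]
    {g : b → MvPolynomial σ K} {d : ℕ} (hg : ∀ j, (g j).IsHomogeneous d) {A : Set (σ →₀ ℕ)}
    (hspan : Ideal.span ((fun a => (monomial a (1 : K) : MvPolynomial σ K)) '' A) =
      Ideal.span (Set.range g)) (k : ℕ) :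
    (Module.finrank K (LinearMap.range (gradedMap (replicateRow Unit g) k)) : ℤ) =
      ∑ c ∈ (Finset.univ : Finset σ).finsuppAntidiag (d + k), upperIndicator A c := by
  classical
  let e := LinearEquiv.funUnique Unit K (MvPolynomial σ K)
  rw [← LinearEquiv.finrank_map_eq e]
  have hmap : Submodule.map (e : (Unit → MvPolynomial σ K) →ₗ[K] MvPolynomial σ K)
      (LinearMap.range (gradedMap (replicateRow Unit g) k)) = restrictSupport K
        (((Finset.univ : Finset σ).finsuppAntidiag (d + k)).filter
          fun c => ∃ a ∈ A, a ≤ c : Finset (σ →₀ ℕ)) := by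
    ext p
    rw [mem_restrictSupport_iff]
    simp only [Submodule.mem_map, LinearMap.mem_range, exists_exists_eq_and, Finset.coe_filter,
      gradedMap_apply]
    constructor
    · rintro ⟨v, rfl⟩ c hc
      have hv : e (replicateRow Unit g *ᵥ fun j => (v j : MvPolynomial σ K)) =
          ∑ j, g j * (v j : MvPolynomial σ K) := rfl
      erw [hv] at hc
      refine ⟨?_, ?_⟩
      · rw [mem_finsuppAntidiag_univ, ← Finsupp.degree_eq_sum]
        have hhom : (∑ j, g j * (v j : MvPolynomial σ K)).IsHomogeneous (d + k) :=
          IsHomogeneous.sum _ _ _ fun j _ => (hg j).mul (v j).2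
        by_contra hne
        exact mem_support_iff.1 hc (hhom.coeff_eq_zero hne)
      · have hmem : ∑ j, g j * (v j : MvPolynomial σ K) ∈
            Ideal.span ((fun a => (monomial a (1 : K) : MvPolynomial σ K)) '' A) := by
          rw [hspan]
          exact Ideal.sum_mem _ fun j _ =>
            Ideal.mul_mem_right _ _ (Ideal.subset_span (Set.mem_range_self j))
        exact mem_ideal_span_monomial_image.1 hmem c hc
    · intro hp
      have hmem : p ∈ Ideal.span (Set.range g) := by
        rw [← hspan]
        exact mem_ideal_span_monomial_image.2 fun c hc => (hp hc).2
      have hhom : p.IsHomogeneous (d + k) := fun c hc => by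
        have := (hp (mem_support_iff.2 hc)).1
        rw [mem_finsuppAntidiag_univ, ← Finsupp.degree_eq_sum] at this
        rw [← this, Finsupp.degree_eq_weight_one]
        rfl
      obtain ⟨w, hw⟩ := Ideal.mem_span_range_iff_exists_fun.1 hmem
      have hw' : (fun _ : Unit => p) = replicateRow Unit g *ᵥ w := by
        funext u
        rw [← hw]
        exact Finset.sum_congr rfl fun j _ => mul_comm _ _
      have hw'' := mulVec_homogeneousComponent (fun _ j => hg j) (fun _ => hhom) hw'
      refine ⟨fun l => ⟨homogeneousComponent k (w l), homogeneousComponent_isHomogeneous _ _⟩, ?_⟩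
      exact (congrFun hw'' ()).symm
  rw [hmap, finrank_restrictSupport]
  simp [upperIndicator]

theorem HasLinearResolution.exists_coeff_degreeSeries [Fintype σ] [DecidableEq σ]
    {A : Set (σ →₀ ℕ)} {d : ℕ} (hA : ∀ a ∈ A, a.degree = d)
    (h : HasLinearResolution
      (Ideal.span ((fun a => (monomial a (1 : K) : MvPolynomial σ K)) '' A)) d) :
    ∃ r : ℕ → ℕ, ∀ k, PowerSeries.coeff (k + d)
      ((1 - PowerSeries.X) ^ Fintype.card σ * degreeSeries (upperIndicator A)) =
        (-1) ^ k * (r k : ℤ) := by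
  obtain ⟨r, g, M, hg, hspan, hM, hex0, hex⟩ := hasLinearResolution_iff.1 h
  refine ⟨r, ?_⟩
  have hrec : ∀ {a b c : Type} [Fintype b] [Fintype c] {D : Matrix a b (MvPolynomial σ K)}
      {D' : Matrix b c (MvPolynomial σ K)}, ExactAt D D' →
      (∀ j k, (D' j k).IsHomogeneous 1) →
      (1 - PowerSeries.X) ^ Fintype.card σ * (PowerSeries.mk fun k =>
        (Module.finrank K (LinearMap.range (gradedMap D k)) : ℤ)) =
      (Fintype.card b : PowerSeries ℤ) - PowerSeries.X *
        ((1 - PowerSeries.X) ^ Fintype.card σ * PowerSeries.mk fun k =>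
          (Module.finrank K (LinearMap.range (gradedMap D' k)) : ℤ)) := by
    intro a b c _ _ D D' hDD' hD'
    have hs : (PowerSeries.mk fun k =>
        (Module.finrank K (LinearMap.range (gradedMap D k)) : ℤ)) =
        (Fintype.card b : PowerSeries ℤ) * degreeSeries (fun _ : σ →₀ ℕ => 1) -
        PowerSeries.X * PowerSeries.mk fun k =>
          (Module.finrank K (LinearMap.range (gradedMap D' k)) : ℤ) := by
      ext k
      have hk := finrank_range_add_finrank_ker_gradedMap D k
      have hcast : (Fintype.card b : PowerSeries ℤ) = PowerSeries.C (Fintype.card b : ℤ) := by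
        simp
      rw [hcast, map_sub, PowerSeries.coeff_C_mul, PowerSeries.coeff_mk]
      cases k with
      | zero =>
        rw [hDD'.finrank_ker_gradedMap_zero hD'] at hk
        simp only [degreeSeries, PowerSeries.coeff_mk, PowerSeries.coeff_zero_X_mul,
          Finset.sum_const, nsmul_eq_mul, mul_one, sub_zero]
        exact_mod_cast hk
      | succ k =>
        rw [hDD'.finrank_ker_gradedMap_succ hD'] at hk
        simp only [degreeSeries, PowerSeries.coeff_mk, PowerSeries.coeff_succ_X_mul,
          Finset.sum_const, nsmul_eq_mul, mul_one]
        rw [eq_sub_iff_add_eq]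
        exact_mod_cast hk
    rw [hs, mul_sub, mul_left_comm, one_sub_X_pow_mul_degreeSeries_one, mul_one]
    ring
  have hseries : degreeSeries (upperIndicator A) = PowerSeries.X ^ d * PowerSeries.mk fun k =>
      (Module.finrank K (LinearMap.range (gradedMap (replicateRow Unit g) k)) : ℤ) := by
    ext k
    rw [PowerSeries.coeff_X_pow_mul', degreeSeries, PowerSeries.coeff_mk]
    split_ifs with hk
    · rw [PowerSeries.coeff_mk, finrank_range_gradedMap_replicateRow hg hspan,
        Nat.add_sub_cancel' hk]
    · refine Finset.sum_eq_zero fun c hc => if_neg ?_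
      rintro ⟨a, ha, hac⟩
      have h1 := Finsupp.degree_mono hac
      rw [hA a ha, Finsupp.degree_eq_sum c, mem_finsuppAntidiag_univ.1 hc] at h1
      exact hk h1
  have hstep : ∀ k i, PowerSeries.coeff k ((1 - PowerSeries.X) ^ Fintype.card σ *
      PowerSeries.mk fun l => (Module.finrank K (LinearMap.range (gradedMap (M i) l)) : ℤ)) =
        (-1) ^ k * (r (i + 1 + k) : ℤ) := by
    intro k
    induction k with
    | zero =>
      intro i
      rw [hrec (hex i) (hM (i + 1))]
      simp
    | succ k ih =>
      intro i
      rw [hrec (hex i) (hM (i + 1)), map_sub, PowerSeries.coeff_succ_X_mul, ih]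
      have hcast : (Fintype.card (Fin (r (i + 1))) : PowerSeries ℤ) =
        PowerSeries.C (r (i + 1) : ℤ) := by simp
      rw [hcast, PowerSeries.coeff_C, if_neg k.succ_ne_zero, add_right_comm i 1 1,
        show i + 1 + 1 + k = i + 1 + (k + 1) by ring]
      ring
  intro k
  rw [hseries, mul_left_comm, PowerSeries.coeff_X_pow_mul, hrec hex0 (hM 0), map_sub]
  have hcast : (Fintype.card (Fin (r 0)) : PowerSeries ℤ) = PowerSeries.C (r 0 : ℤ) := by simp
  rw [hcast, PowerSeries.coeff_C]
  cases k with
  | zero => simp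
  | succ k =>
    rw [PowerSeries.coeff_succ_X_mul, hstep, if_neg k.succ_ne_zero, add_comm (0 + 1) k]
    ring

end Hilbert

section Quadratic

open Finset

variable {K : Type*} [Field K] {σ : Type*}

theorem exists_eq_single_add {a : σ →₀ ℕ} {k : ℕ} (ha : a.degree = k + 1) :
    ∃ p b, a = Finsupp.single p 1 + b ∧ b.degree = k := by
  have hne : a ≠ 0 := by
    rintro rfl
    simp at ha
  obtain ⟨p, hp⟩ := Finsupp.ne_iff.1 hne
  have hp' : Finsupp.single p 1 ≤ a := Finsupp.single_le_iff.2 (Nat.one_le_iff_ne_zero.2 hp)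
  obtain ⟨b, rfl⟩ := exists_add_of_le hp'
  refine ⟨p, b, rfl, ?_⟩
  rw [map_add, Finsupp.degree_single] at ha
  omega

theorem exists_eq_single_add_single {a : σ →₀ ℕ} (ha : a.degree = 2) :
    ∃ p q, a = Finsupp.single p 1 + Finsupp.single q 1 := by
  obtain ⟨p, b, rfl, hb⟩ := exists_eq_single_add ha
  obtain ⟨q, c, rfl, hc⟩ := exists_eq_single_add hb
  rw [(Finsupp.degree_eq_zero_iff c).1 hc, add_zero]
  exact ⟨p, q, rfl⟩

theorem upperIndicator_pair {u v : σ →₀ ℕ} (huv : ∀ i, u i = 0 ∨ v i = 0) (b : σ →₀ ℕ) :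
    upperIndicator {u, v} b =
      upperIndicator {u} b + upperIndicator {v} b - upperIndicator {u + v} b := by
  have h : u + v ≤ b ↔ u ≤ b ∧ v ≤ b := by
    simp only [Finsupp.le_def, Finsupp.add_apply, ← forall_and]
    refine forall_congr' fun i => ?_
    have := huv i
    omega
  simp only [upperIndicator, Set.mem_insert_iff, Set.mem_singleton_iff, exists_eq_or_imp,
    exists_eq_left, h]
  by_cases h1 : u ≤ b <;> by_cases h2 : v ≤ b <;> simp [h1, h2]

variable [Fintype σ] [DecidableEq σ]

theorem degreeSeries_upperIndicator_singleton (u : σ →₀ ℕ) :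
    degreeSeries (upperIndicator {u}) =
      PowerSeries.X ^ (∑ i, u i) * degreeSeries fun _ : σ →₀ ℕ => 1 := by
  ext k
  rw [PowerSeries.coeff_X_pow_mul', degreeSeries, degreeSeries, PowerSeries.coeff_mk,
    PowerSeries.coeff_mk, ← sum_shift]
  simp [upperIndicator]

/-- A complete intersection of two quadrics does not have a linear resolution. -/
theorem not_hasLinearResolution_pair {u v : σ →₀ ℕ} (hu : u.degree = 2) (hv : v.degree = 2)
    (huv : ∀ i, u i = 0 ∨ v i = 0) :
    ¬ HasLinearResolution
      (Ideal.span ((fun a => (monomial a (1 : K) : MvPolynomial σ K)) '' {u, v})) 2 := by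
  intro h
  obtain ⟨r, hr⟩ := h.exists_coeff_degreeSeries (by simp [hu, hv])
  have h4 := hr 2
  have hs : degreeSeries (upperIndicator {u, v}) = degreeSeries (upperIndicator {u}) +
      degreeSeries (upperIndicator {v}) - degreeSeries (upperIndicator {u + v}) := by
    ext k
    simp [degreeSeries, upperIndicator_pair huv, sum_add_distrib, sum_sub_distrib]
  rw [hs] at h4
  simp only [degreeSeries_upperIndicator_singleton, ← Finsupp.degree_eq_sum, map_add, hu, hv,
    mul_add, mul_sub, mul_left_comm _ (PowerSeries.X ^ _), one_sub_X_pow_mul_degreeSeries_one,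
    mul_one, map_sub, PowerSeries.coeff_X_pow] at h4
  norm_num at h4
  omega

theorem sum_upperIndicator_nonneg {A : Set (σ →₀ ℕ)} (hA : ∀ a ∈ A, a.degree = 2)
    (hsq : ∀ a ∈ A, ∀ i, a i ≤ 1)
    (h : HasLinearResolution
      (Ideal.span ((fun a => (monomial a (1 : K) : MvPolynomial σ K)) '' A)) 2)
    {W : Finset σ} (hW : 2 ≤ #W) :
    0 ≤ ∑ F ∈ W.powerset, (-1) ^ #F * upperIndicator A (sqfreeExp F) := by
  obtain ⟨r, hr⟩ := (h.restrict_finset Wᶜ).exists_coeff_degreeSeries fun a ha => hA a ha.1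
  have hr := hr (#W - 2)
  rw [Nat.sub_add_cancel hW, coeff_one_sub_X_pow_mul_degreeSeries,
    sum_eq_single (sqfreeExp W), koszulSum_sqfreeExp] at hr
  · have hsum : ∀ F ∈ W.powerset,
        (-1) ^ (#W + #F) * upperIndicator {a ∈ A | ∀ i ∈ Wᶜ, a i = 0} (sqfreeExp F) =
        (-1) ^ #W * ((-1) ^ #F * upperIndicator A (sqfreeExp F)) := by
      intro F hF
      rw [pow_add, mul_assoc]
      congr 2
      unfold upperIndicator
      congr 1
      refine propext ⟨fun ⟨a, ha, hle⟩ => ⟨a, ha.1, hle⟩, fun ⟨a, ha, hle⟩ =>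
        ⟨a, ⟨ha, fun i hi => ?_⟩, hle⟩⟩
      have hi' := hle i
      rw [sqfreeExp_apply, if_neg fun hiF => mem_compl.1 hi (mem_powerset.1 hF hiF)] at hi'
      exact Nat.le_zero.1 hi'
    rw [sum_congr rfl hsum, ← mul_sum] at hr
    obtain ⟨m, hm⟩ := Nat.exists_eq_add_of_le' hW
    rw [hm, Nat.add_sub_cancel, pow_add] at hr
    have h1 : ((-1 : ℤ) ^ m) ≠ 0 := by simp
    have h2 := mul_left_cancel₀ h1 ((by simpa using hr : _ = _))
    rw [h2]
    positivity
  · intro c hc hcW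
    rw [mem_finsuppAntidiag_univ] at hc
    obtain ⟨i, hi⟩ : ∃ i, sqfreeExp W i < c i := by
      by_contra! hle
      refine hcW (Finsupp.ext fun i => ?_)
      exact (sum_eq_sum_iff_of_le fun i _ => hle i).1 (hc.trans (sum_sqfreeExp W).symm) i
        (mem_univ i)
    refine koszulSum_eq_zero (by omega : c i ≠ 0) fun b hb => ?_
    unfold upperIndicator
    congr 1
    refine propext ⟨fun ⟨a, ha, hle⟩ => ⟨a, ha, fun l => ?_⟩, fun ⟨a, ha, hle⟩ =>
      ⟨a, ha, hle.trans le_self_add⟩⟩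
    have hl := hle l
    rw [Finsupp.add_apply, Finsupp.single_apply] at hl
    split_ifs at hl with hil
    · subst hil
      rw [sqfreeExp_apply] at hi
      split_ifs at hi with hiW
      · exact (hsq a ha.1 i).trans (by omega)
      · rw [ha.2 i (mem_compl.2 hiW)]
        exact Nat.zero_le _
    · exact hl
  · intro hn
    exact absurd (mem_finsuppAntidiag_univ.2 (sum_sqfreeExp W)) hn

end Quadratic

section Simplicial

open Finset

variable {V : Type*} [DecidableEq V] (H : SimpleGraph V)

open Classical in
/-- The alternating count of the cliques contained in `W`, the empty clique included. -/
noncomputable def cliqueEuler (W : Finset V) : ℤ :=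
  ∑ F ∈ W.powerset, (-1) ^ #F * if H.IsClique (F : Set V) then 1 else 0

theorem cliqueEuler_empty : cliqueEuler H ∅ = 1 := by
  simp [cliqueEuler]

open Classical in
theorem cliqueEuler_insert {v : V} {W : Finset V} (hv : v ∉ W) :
    cliqueEuler H (insert v W) =
      cliqueEuler H W - cliqueEuler H (W.filter fun w => H.Adj v w) := by
  unfold cliqueEuler
  rw [sum_powerset_insert hv, sub_eq_add_neg]
  congr 1
  rw [← sum_subset (powerset_mono.2 (filter_subset (fun w => H.Adj v w) W)), ← sum_neg_distrib]
  · refine sum_congr rfl fun F hF => ?_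
    have hF' := mem_powerset.1 hF
    have hadj : ∀ w ∈ F, H.Adj v w := fun w hw => (mem_filter.1 (hF' hw)).2
    have hvF : v ∉ F := fun h => hv (mem_filter.1 (hF' h)).1
    have hc : H.IsClique (insert v F : Finset V) ↔ H.IsClique (F : Set V) := by
      rw [coe_insert, SimpleGraph.isClique_insert]
      exact ⟨fun h => h.1, fun h => ⟨h, fun w hw _ => hadj w hw⟩⟩
    simp only [hc, card_insert_of_notMem hvF]
    ring
  · intro F hF hF'
    have hvF : v ∉ F := fun h => hv (mem_powerset.1 hF h)
    rw [if_neg, mul_zero]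
    intro hc
    rw [coe_insert, SimpleGraph.isClique_insert] at hc
    refine hF' (mem_powerset.2 fun w hw => mem_filter.2 ⟨mem_powerset.1 hF hw, ?_⟩)
    exact hc.2 w hw fun h => hvF (h ▸ hw)

theorem cliqueEuler_singleton (v : V) : cliqueEuler H {v} = 0 := by
  classical
  rw [← insert_empty_eq, cliqueEuler_insert H (notMem_empty v)]
  simp

/-- The finite vertex sets which can be built up by successively adding neighbours. -/
inductive Buildable : Finset V → Prop
  | single (v : V) : Buildable {v}
  | grow {W : Finset V} {v w : V} (hW : Buildable W) (hw : w ∈ W) (hadj : H.Adj v w) :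
      Buildable (insert v W)

variable {H}

theorem Buildable.nonempty {W : Finset V} (hW : Buildable H W) : W.Nonempty := by
  cases hW with
  | single v => exact singleton_nonempty v
  | grow => exact insert_nonempty _ _

theorem Buildable.cliqueEuler_eq_zero (hH : ∀ W : Finset V, W.Nonempty → cliqueEuler H W ≤ 0)
    {W : Finset V} (hW : Buildable H W) : cliqueEuler H W = 0 := by
  classical
  induction hW with
  | single v => exact cliqueEuler_singleton H v
  | @grow W v w hW hw hadj ih =>
    by_cases hv : v ∈ W
    · rwa [insert_eq_of_mem hv]
    · refine le_antisymm (hH _ (insert_nonempty _ _)) ?_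
      rw [cliqueEuler_insert H hv, ih]
      have := hH (W.filter fun w => H.Adj v w) ⟨w, mem_filter.2 ⟨hw, hadj⟩⟩
      omega

theorem cliqueEuler_pair {x y : V} (hne : x ≠ y) (hxy : ¬ H.Adj x y) :
    cliqueEuler H {x, y} = -1 := by
  classical
  rw [cliqueEuler_insert H (by simpa using hne), cliqueEuler_singleton]
  simp [filter_singleton, hxy, cliqueEuler_empty]

/-- If the Euler characteristic condition holds, each finite vertex set has a simplicial vertex. -/
theorem exists_simplicial (hH : ∀ W : Finset V, W.Nonempty → cliqueEuler H W ≤ 0)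
    (U : Finset V) (hU : U.Nonempty) :
    ∃ v ∈ U, ∀ x ∈ U, ∀ y ∈ U, H.Adj v x → H.Adj v y → x ≠ y → H.Adj x y := by
  classical
  induction U using Finset.strongInduction with
  | H U ih =>
  by_cases hcomp : H.IsClique (U : Set V)
  · obtain ⟨v, hv⟩ := hU
    exact ⟨v, hv, fun x hx y hy _ _ hxy => hcomp hx hy hxy⟩
  let far : Finset V → Finset V := fun A => U.filter fun r => r ∉ A ∧ ∀ a ∈ A, ¬ H.Adj r a
  have hcand : (U.powerset.filter fun A => Buildable H A ∧ (far A).Nonempty).Nonempty := by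
    obtain ⟨p, hp, q, hq, hpq, hadj⟩ : ∃ p ∈ U, ∃ q ∈ U, p ≠ q ∧ ¬ H.Adj p q := by
      simpa [SimpleGraph.isClique_iff, Set.Pairwise] using hcomp
    refine ⟨{p}, mem_filter.2 ⟨by simpa using hp, .single p, q, mem_filter.2 ⟨hq, ?_, ?_⟩⟩⟩
    · simpa using hpq.symm
    · simpa [SimpleGraph.adj_comm] using hadj
  obtain ⟨A, hAmem, hmax⟩ := exists_max_image _ card hcand
  obtain ⟨hAU, hA, hfar⟩ := mem_filter.1 hAmem
  rw [mem_powerset] at hAU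
  have hjoin : ∀ s ∈ U, s ∉ A → (∃ a ∈ A, H.Adj s a) → ∀ r ∈ far A, H.Adj r s := by
    rintro s hs hsA ⟨a, ha, hsa⟩ r hr
    by_contra hrs
    obtain ⟨hrU, hrA, hra⟩ := mem_filter.1 hr
    have hcard := hmax (insert s A) (mem_filter.2 ⟨mem_powerset.2 (insert_subset hs hAU),
      .grow hA ha hsa, r, mem_filter.2 ⟨hrU, ?_, ?_⟩⟩)
    · rw [card_insert_of_notMem hsA] at hcard
      omega
    · rw [mem_insert, not_or]
      exact ⟨fun h => hra a ha (h ▸ hsa), hrA⟩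
    · intro b hb
      rcases mem_insert.1 hb with rfl | hb
      exacts [hrs, hra b hb]
  have hclique : ∀ x ∈ U, ∀ y ∈ U, x ∉ A → y ∉ A → (∃ a ∈ A, H.Adj x a) →
      (∃ a ∈ A, H.Adj y a) → x ≠ y → H.Adj x y := by
    rintro x hx y hy hxA hyA ⟨a, ha, hxa⟩ ⟨b, hb, hyb⟩ hne
    by_contra hxy
    obtain ⟨r, hr⟩ := hfar
    have hrx := hjoin x hx hxA ⟨a, ha, hxa⟩ r hr
    have hry := hjoin y hy hyA ⟨b, hb, hyb⟩ r hr
    obtain ⟨-, hrA, hra⟩ := mem_filter.1 hr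
    have hbuild : Buildable H (insert x (insert y A)) :=
      .grow (.grow hA hb hyb) (mem_insert_of_mem ha) hxa
    have hrW : r ∉ insert x (insert y A) := by
      simp [hrx.ne, hry.ne, hrA]
    have hN : (insert x (insert y A)).filter (fun w => H.Adj r w) = {x, y} := by
      rw [filter_insert, if_pos hrx, filter_insert, if_pos hry, filter_eq_empty_iff.2 hra,
        insert_empty_eq]
    have hle := hH (insert r (insert x (insert y A))) (insert_nonempty _ _)
    rw [cliqueEuler_insert H hrW, hN, hbuild.cliqueEuler_eq_zero hH, cliqueEuler_pair hne hxy]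
      at hle
    omega
  obtain ⟨a, ha⟩ := hA.nonempty
  have hss : far A ⊂ U := (filter_subset _ _).ssubset_of_ne fun h =>
    (mem_filter.1 (h.symm.subset (hAU ha))).2.1 ha
  obtain ⟨v, hv, hsimp⟩ := ih (far A) hss hfar
  obtain ⟨hvU, hvA, hva⟩ := mem_filter.1 hv
  have hcases : ∀ x ∈ U, H.Adj v x → x ∉ A ∧ (x ∈ far A ∨ ∃ a ∈ A, H.Adj x a) := by
    intro x hx hvx
    have hxA : x ∉ A := fun h => hva x h hvx
    refine ⟨hxA, ?_⟩
    by_cases h : ∃ a ∈ A, H.Adj x a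
    · exact .inr h
    · push Not at h
      exact .inl (mem_filter.2 ⟨hx, hxA, h⟩)
  refine ⟨v, hvU, fun x hx y hy hvx hvy hne => ?_⟩
  obtain ⟨hxA, hx' | hx'⟩ := hcases x hx hvx <;> obtain ⟨hyA, hy' | hy'⟩ := hcases y hy hvy
  · exact hsimp x hx' y hy' hvx hvy hne
  · exact hjoin y hy hyA hy' x hx'
  · exact (hjoin x hx hxA hx' y hy').symm
  · exact hclique x hx y hy hxA hyA hx' hy' hne

end Simplicial

section Dominating

open Finset

variable {K : Type*} [Field K] {σ : Type*} [DecidableEq σ]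

/-- The graph whose edges are the squarefree quadratic monomials outside `A`. -/
def nonGeneratorGraph (A : Set (σ →₀ ℕ)) : SimpleGraph σ where
  Adj p q := p ≠ q ∧ Finsupp.single p 1 + Finsupp.single q 1 ∉ A
  symm := ⟨fun p q h => ⟨h.1.symm, by rw [add_comm]; exact h.2⟩⟩
  loopless := ⟨fun _ h => h.1 rfl⟩

theorem exists_le_sqfreeExp_iff {A : Set (σ →₀ ℕ)} (hA : ∀ a ∈ A, a.degree = 2)
    (hsq : ∀ a ∈ A, ∀ i, a i ≤ 1) (F : Finset σ) :
    (∃ a ∈ A, a ≤ sqfreeExp F) ↔ ¬ (nonGeneratorGraph A).IsClique (F : Set σ) := by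
  constructor
  · rintro ⟨a, ha, hle⟩ hc
    obtain ⟨p, q, rfl⟩ := exists_eq_single_add_single (hA a ha)
    have hpq : p ≠ q := by
      rintro rfl
      simpa using hsq _ ha p
    have hmem : ∀ i, (Finsupp.single p 1 + Finsupp.single q 1 : σ →₀ ℕ) i ≠ 0 → i ∈ F := by
      intro i hi
      by_contra hiF
      have := hle i
      rw [sqfreeExp_apply, if_neg hiF] at this
      omega
    exact (hc (hmem p (by simp)) (hmem q (by simp)) hpq).2 ha
  · intro hc
    simp only [SimpleGraph.isClique_iff, Set.Pairwise] at hc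
    push Not at hc
    obtain ⟨p, hp, q, hq, hpq, hadj⟩ := hc
    refine ⟨Finsupp.single p 1 + Finsupp.single q 1, not_not.1 fun h => hadj ⟨hpq, h⟩, ?_⟩
    rw [← sum_pair (f := fun i => Finsupp.single i 1) hpq]
    refine sqfreeExp_le_iff.2 fun i hi => ?_
    have hiF : i ∈ F := by
      rcases mem_insert.1 hi with rfl | hi
      · exact hp
      · rw [mem_singleton.1 hi]
        exact hq
    simp [sqfreeExp_apply, hiF]

variable [Fintype σ]

theorem cliqueEuler_nonGeneratorGraph_nonpos {A : Set (σ →₀ ℕ)} (hA : ∀ a ∈ A, a.degree = 2)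
    (hsq : ∀ a ∈ A, ∀ i, a i ≤ 1)
    (h : HasLinearResolution
      (Ideal.span ((fun a => (monomial a (1 : K) : MvPolynomial σ K)) '' A)) 2)
    {W : Finset σ} (hW : W.Nonempty) : cliqueEuler (nonGeneratorGraph A) W ≤ 0 := by
  classical
  obtain h1 | h2 : #W = 1 ∨ 2 ≤ #W := by
    have := hW.card_pos
    omega
  · obtain ⟨v, rfl⟩ := card_eq_one.1 h1
    exact (cliqueEuler_singleton _ v).le
  · have hsum := sum_upperIndicator_nonneg hA hsq h h2
    have hind : ∀ F : Finset σ, upperIndicator A (sqfreeExp F) =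
        1 - if (nonGeneratorGraph A).IsClique (F : Set σ) then 1 else 0 := by
      intro F
      unfold upperIndicator
      rw [exists_le_sqfreeExp_iff hA hsq]
      split_ifs <;> simp_all
    simp only [hind, mul_sub, mul_one, sum_sub_distrib] at hsum
    rw [sum_powerset_neg_one_pow_card_of_nonempty hW] at hsum
    unfold cliqueEuler
    linarith

theorem square_dominates {A : Set (σ →₀ ℕ)} (hA : ∀ a ∈ A, a.degree = 2)
    (h : HasLinearResolution
      (Ideal.span ((fun a => (monomial a (1 : K) : MvPolynomial σ K)) '' A)) 2)
    {i p q : σ} (hi : Finsupp.single i 1 + Finsupp.single i 1 ∈ A) (hp : p ≠ i) (hq : q ≠ i)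
    (hpq : Finsupp.single p 1 + Finsupp.single q 1 ∈ A)
    (hpp : p ≠ q → Finsupp.single p 1 + Finsupp.single p 1 ∉ A)
    (hqq : p ≠ q → Finsupp.single q 1 + Finsupp.single q 1 ∉ A) :
    Finsupp.single i 1 + Finsupp.single p 1 ∈ A ∨
      Finsupp.single i 1 + Finsupp.single q 1 ∈ A := by
  by_contra! hno
  obtain ⟨hip, hiq⟩ := hno
  refine not_hasLinearResolution_pair (K := K) (hA _ hi) (hA _ hpq) (fun l => ?_) ?_
  · by_cases hl : l = i
    · subst hl
      simp [hp, hq]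
    · simp [hl]
  convert h.restrict_finset {i, p, q}ᶜ using 3
  ext a
  constructor
  · rintro (rfl | rfl)
    · refine ⟨hi, fun l hl => ?_⟩
      simp only [mem_compl, mem_insert, mem_singleton, not_or] at hl
      simp [hl.1]
    · refine ⟨hpq, fun l hl => ?_⟩
      simp only [mem_compl, mem_insert, mem_singleton, not_or] at hl
      simp [hl.2.1, hl.2.2]
  · rintro ⟨ha, hsupp⟩
    obtain ⟨s, t, rfl⟩ := exists_eq_single_add_single (hA a ha)
    have hmem : ∀ l, (Finsupp.single s 1 + Finsupp.single t 1 : σ →₀ ℕ) l ≠ 0 →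
        l = i ∨ l = p ∨ l = q := by
      intro l hl
      by_contra hn
      exact hl (hsupp l (by simpa using hn))
    have hs := hmem s (by simp)
    have ht := hmem t (by simp)
    by_cases hne : p = q
    · subst hne
      rcases hs with rfl | rfl | rfl <;> rcases ht with rfl | rfl | rfl <;>
        simp_all [add_comm]
    · have hpp := hpp hne
      have hqq := hqq hne
      rcases hs with rfl | rfl | rfl <;> rcases ht with rfl | rfl | rfl <;>
        simp_all [add_comm]

/-- A quadratic monomial ideal with linear resolution has a variable `x_i` such that each
generator `x_p x_q` not divisible by `x_i` satisfies `x_i x_p ∈ G(I)` or `x_i x_q ∈ G(I)`. -/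
theorem HasLinearResolution.exists_dominating [Nonempty σ] {A : Set (σ →₀ ℕ)}
    (hA : ∀ a ∈ A, a.degree = 2)
    (h : HasLinearResolution
      (Ideal.span ((fun a => (monomial a (1 : K) : MvPolynomial σ K)) '' A)) 2) :
    ∃ i, ∀ p q, p ≠ i → q ≠ i → Finsupp.single p 1 + Finsupp.single q 1 ∈ A →
      Finsupp.single i 1 + Finsupp.single p 1 ∈ A ∨
        Finsupp.single i 1 + Finsupp.single q 1 ∈ A := by
  by_cases hs : ∃ i, Finsupp.single i 1 + Finsupp.single i 1 ∈ A
  · obtain ⟨i, hi⟩ := hs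
    refine ⟨i, fun p q hp hq hpq => ?_⟩
    by_contra! hno
    have hsquare : ∀ l, l ≠ i → Finsupp.single i 1 + Finsupp.single l 1 ∉ A →
        Finsupp.single l 1 + Finsupp.single l 1 ∉ A := fun l hl hil hll =>
      hil (or_self_iff.1 (square_dominates hA h hi hl hl hll (fun h => (h rfl).elim)
        fun h => (h rfl).elim))
    obtain hip | hiq := square_dominates hA h hi hp hq hpq (fun _ => hsquare p hp hno.1)
      fun _ => hsquare q hq hno.2
    exacts [hno.1 hip, hno.2 hiq]
  · push Not at hs
    have hsq : ∀ a ∈ A, ∀ i, a i ≤ 1 := by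
      intro a ha i
      obtain ⟨p, q, rfl⟩ := exists_eq_single_add_single (hA a ha)
      have hpq : p ≠ q := fun h => hs p (by rwa [← h] at ha)
      simp only [Finsupp.add_apply, Finsupp.single_apply]
      split_ifs with h1 h2 <;> simp_all
    obtain ⟨i, -, hi⟩ := exists_simplicial
      (fun W hW => cliqueEuler_nonGeneratorGraph_nonpos hA hsq h hW) univ univ_nonempty
    refine ⟨i, fun p q hp hq hpq => ?_⟩
    by_contra! hno
    have hne : p ≠ q := fun h => hs p (by rwa [← h] at hpq)
    exact (hi p (mem_univ p) q (mem_univ q) ⟨hp.symm, hno.1⟩ ⟨hq.symm, hno.2⟩ hne).2 hpq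

end Dominating

section Rename

variable {K : Type*} [Field K] {σ τ : Type*}

theorem map_rename_span_monomial (e : σ ≃ τ) (A : Set (σ →₀ ℕ)) :
    Ideal.map (rename e)
        (Ideal.span ((fun a => (monomial a (1 : K) : MvPolynomial σ K)) '' A)) =
      Ideal.span ((fun a => (monomial a (1 : K) : MvPolynomial τ K)) ''
        (Finsupp.equivMapDomain e '' A)) := by
  rw [Ideal.map_span, Set.image_image, Set.image_image]
  simp only [rename_monomial, Finsupp.equivMapDomain_eq_mapDomain]

theorem HasLinearResolution.map_rename {I : Ideal (MvPolynomial σ K)} {d : ℕ}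
    (h : HasLinearResolution I d) (e : σ ≃ τ) :
    HasLinearResolution (I.map (rename e : MvPolynomial σ K →ₐ[K] MvPolynomial τ K)) d := by
  obtain ⟨r, g, M, hg, rfl, hM, hex0, hex⟩ := h
  have hinv : ∀ p : MvPolynomial τ K, rename e (rename e.symm p) = p := fun p => by
    rw [rename_rename, e.self_comp_symm, rename_id_apply]
  have hinj := rename_injective (R := K) e e.injective
  have hmul : ∀ {b : ℕ} (m : Fin b → MvPolynomial σ K) (v : Fin b → MvPolynomial τ K),
      ∑ k, rename e (m k) * v k = rename e (∑ k, m k * rename e.symm (v k)) := fun m v => by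
    simp only [map_sum, map_mul, hinv]
  have himage : ∀ {a b : ℕ} (N : Fin a → Fin b → MvPolynomial σ K)
      (v : Fin a → MvPolynomial τ K),
      (∃ w : Fin b → MvPolynomial σ K,
        (fun j => rename e.symm (v j)) = fun j => ∑ k, N j k * w k) ↔
      ∃ w : Fin b → MvPolynomial τ K, v = fun j => ∑ k, rename e (N j k) * w k := by
    intro a b N v
    constructor
    · rintro ⟨w, hw⟩
      refine ⟨fun k => rename e (w k), funext fun j => ?_⟩
      rw [← hinv (v j), congrFun hw j, map_sum]
      simp only [map_mul]
    · rintro ⟨w, rfl⟩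
      refine ⟨fun k => rename e.symm (w k), funext fun j => hinj ?_⟩
      rw [hinv]
      exact hmul _ _
  refine ⟨r, fun j => rename e (g j), fun i j k => rename e (M i j k),
    fun j => (hg j).rename_isHomogeneous, ?_, fun i j k => (hM i j k).rename_isHomogeneous, ?_, ?_⟩
  · rw [Ideal.map_span, ← Set.range_comp]
    rfl
  · intro v
    rw [← himage, ← hex0, ← map_eq_zero_iff _ hinj]
    simp only [map_sum, map_mul, hinv]
  · intro i v
    rw [← himage, ← hex]
    simp only [_root_.funext_iff, hmul, map_eq_zero_iff _ hinj]

end Rename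

/-- **Lemma 2.4.** Let `I` be a quadratic monomial ideal with linear resolution, with
minimal monomial generating set `A`.  Then, up to a relabelling `σ` of the variables,
`I = x_1·P + J` where `P = (u/x_1 : u ∈ G(I), x_1 ∣ u)` and
`J = (u ∈ G(I) : x_1 ∤ u)`; moreover `J ⊆ P` and `J` has a linear resolution.
(Here `x_1` is the variable of index `0`.) -/
theorem decomposition_x1P_plus_J {K : Type*} [Field K] {n : ℕ}
    (I : Ideal (MvPolynomial (Fin (n + 1)) K)) (A : Set (Fin (n + 1) →₀ ℕ))
    (hdeg : ∀ a ∈ A, a.sum (fun _ e => e) = 2)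
    (hgen : I = Ideal.span ((fun a => (monomial a (1 : K) :
      MvPolynomial (Fin (n + 1)) K)) '' A))
    (hmin : ∀ a ∈ A, ∀ b ∈ A, a ≤ b → a = b)
    (hlin : HasLinearResolution I 2) :
    ∃ σ : Equiv.Perm (Fin (n + 1)),
      letI B : Set (Fin (n + 1) →₀ ℕ) := (Finsupp.equivMapDomain σ) '' A
      letI P : Ideal (MvPolynomial (Fin (n + 1)) K) :=
        Ideal.span ((fun b => (monomial (b - Finsupp.single 0 1) (1 : K) :
          MvPolynomial (Fin (n + 1)) K)) '' {b ∈ B | Finsupp.single 0 1 ≤ b})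
      letI J : Ideal (MvPolynomial (Fin (n + 1)) K) :=
        Ideal.span ((fun b => (monomial b (1 : K) :
          MvPolynomial (Fin (n + 1)) K)) '' {b ∈ B | ¬ Finsupp.single 0 1 ≤ b})
      Ideal.map (rename σ) I = Ideal.span {(X 0 : MvPolynomial (Fin (n + 1)) K)} * P + J ∧
      J ≤ P ∧ HasLinearResolution J 2 := by
  have hA : ∀ a ∈ A, a.degree = 2 := hdeg
  rw [hgen] at hlin
  obtain ⟨i, hi⟩ := hlin.exists_dominating hA
  let σ := Equiv.swap i 0
  have hσ : σ.symm 0 = i := by simp [σ]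
  have hcoord : ∀ a : Fin (n + 1) →₀ ℕ,
      Finsupp.single 0 1 ≤ Finsupp.equivMapDomain σ a ↔ a i ≠ 0 := fun a => by
    rw [Finsupp.single_le_iff, Finsupp.equivMapDomain_apply, hσ, Nat.one_le_iff_ne_zero]
  refine ⟨σ, ?_, ?_, ?_⟩
  · rw [hgen, map_rename_span_monomial, Ideal.add_eq_sup]
    apply le_antisymm
    · rw [Ideal.span_le]
      rintro _ ⟨b, hb, rfl⟩
      by_cases h0 : Finsupp.single 0 1 ≤ b
      · have hmul : (monomial b (1 : K) : MvPolynomial (Fin (n + 1)) K) =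
            X 0 * monomial (b - Finsupp.single 0 1) 1 := by
          rw [X, monomial_mul, one_mul, add_tsub_cancel_of_le h0]
        simp only [hmul]
        exact Ideal.mem_sup_left (Ideal.mul_mem_mul (Ideal.mem_span_singleton_self _)
          (Ideal.subset_span ⟨b, ⟨hb, h0⟩, rfl⟩))
      · exact Ideal.mem_sup_right (Ideal.subset_span ⟨b, ⟨hb, h0⟩, rfl⟩)
    · refine sup_le ?_ (Ideal.span_mono (Set.image_mono fun b hb => hb.1))
      rw [Ideal.span_mul_span', Ideal.span_le, Set.singleton_mul]
      rintro _ ⟨_, ⟨b, ⟨hb, h0⟩, rfl⟩, rfl⟩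
      refine Ideal.subset_span ⟨b, hb, ?_⟩
      simp only [X, monomial_mul, one_mul, add_tsub_cancel_of_le h0]
  · rw [Ideal.span_le]
    rintro _ ⟨_, ⟨⟨a, ha, rfl⟩, h0⟩, rfl⟩
    obtain ⟨p, q, rfl⟩ := exists_eq_single_add_single (hA a ha)
    rw [hcoord, not_not, Finsupp.add_apply, Nat.add_eq_zero_iff] at h0
    have hp : p ≠ i := by
      rintro rfl
      simp at h0
    have hq : q ≠ i := by
      rintro rfl
      simp at h0
    have hvar : ∀ l, Finsupp.single i 1 + Finsupp.single l 1 ∈ A →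
        (X (σ l) : MvPolynomial (Fin (n + 1)) K) ∈
          Ideal.span ((fun b => (monomial (b - Finsupp.single 0 1) (1 : K) :
            MvPolynomial (Fin (n + 1)) K)) ''
              {b ∈ Finsupp.equivMapDomain σ '' A | Finsupp.single 0 1 ≤ b}) := by
      intro l hl
      refine Ideal.subset_span ⟨_, ⟨⟨_, hl, rfl⟩, (hcoord _).2 (by simp)⟩, ?_⟩
      simp [Finsupp.equivMapDomain_eq_mapDomain, Finsupp.mapDomain_add, σ, X]
    have hmul : (monomial (Finsupp.equivMapDomain σ (Finsupp.single p 1 + Finsupp.single q 1))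
        (1 : K) : MvPolynomial (Fin (n + 1)) K) = X (σ p) * X (σ q) := by
      simp [Finsupp.equivMapDomain_eq_mapDomain, Finsupp.mapDomain_add, X, monomial_mul]
    simp only [hmul]
    obtain hip | hiq := hi p q hp hq ha
    · exact Ideal.mul_mem_right _ _ (hvar p hip)
    · exact Ideal.mul_mem_left _ _ (hvar q hiq)
  · have hres := (hlin.restrict i).map_rename σ
    rw [map_rename_span_monomial] at hres
    convert hres using 3
    ext b
    constructor
    · rintro ⟨⟨a, ha, rfl⟩, h0⟩
      exact ⟨a, ⟨ha, not_not.1 (mt (hcoord a).2 h0)⟩, rfl⟩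
    · rintro ⟨a, ⟨ha, h0⟩, rfl⟩
      exact ⟨⟨a, ha, rfl⟩, fun h => (hcoord a).1 h h0⟩
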